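/- Let (M, ρ) consist of a unital C*-algebra with a tracial state, let A, B ∈ M be self-adjoint with ρ(A) = ρ(B) = 0, and let α, β ∈ ℕ. In M^{⊗N} with state ρ^{⊗N}, set Ã = (A^{(1)} + ⋯ + A^{(N)})/√N and B̃ defined analogously. Then ‖[Ã^α, B̃^β]‖_{ρ^{⊗N}} ≤ C·N^{−1/2}·‖A‖^α ‖B‖^β for a constant C depending only on α and β, where ‖x‖_τ = √(τ(x*x)). -/

import Mathlib

open scoped ComplexOrder in
lemma aux_state_bound {A : Type} [NormedRing A] [StarRing A] [CStarRing A] [NormedAlgebra ℂ A]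
    [CompleteSpace A] [StarModule ℂ A] (φ : A →ₗ[ℂ] ℂ)
    (h0 : ∀ x : A, 0 ≤ (φ (star x * x)).re ∧ (φ (star x * x)).im = 0) (h1 : φ 1 = 1) (x : A) :
    ‖φ x‖ ≤ 4 * ‖x‖ := by
  let _ : CStarAlgebra A := {}
  let _ : PartialOrder A := CStarAlgebra.spectralOrder A
  have _ : StarOrderedRing A := CStarAlgebra.spectralOrderedRing A
  have hpos : ∀ y : A, 0 ≤ y → 0 ≤ φ y := by
    intro y hy
    obtain ⟨z, rfl⟩ := CStarAlgebra.nonneg_iff_eq_star_mul_self.mp hy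
    have := h0 z
    rw [Complex.le_def]
    exact ⟨by simpa using this.1, by simpa using this.2.symm⟩
  let f : A →ₚ[ℂ] ℂ := { φ with
    monotone' := by
      intro a b hab
      have := hpos (b - a) (sub_nonneg.mpr hab)
      rw [map_sub] at this
      exact sub_nonneg.mp this }
  have hf : ∀ y, f y = φ y := fun y => rfl
  obtain ⟨y, hy_nonneg, hy_norm, hy⟩ := CStarAlgebra.exists_sum_four_nonneg x
  conv_lhs => rw [hy]
  simp only [map_sum, map_smul]
  apply (norm_sum_le _ _).trans
  simp only [norm_smul, norm_pow, Complex.norm_I, one_pow, one_mul]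
  have : ∀ i ∈ Finset.univ, ‖φ (y i)‖ ≤ ‖x‖ := by
    intro i _
    have := PositiveLinearMap.norm_apply_le_of_nonneg f (y i) (hy_nonneg i)
    rw [hf, hf, h1] at this
    simpa using this.trans (by simpa using hy_norm i)
  apply (Finset.sum_le_sum this).trans
  simp

lemma aux_hom_bound {A B : Type} [NormedRing A] [StarRing A] [CStarRing A] [NormedAlgebra ℂ A]
    [CompleteSpace A] [StarModule ℂ A] [NormedRing B] [StarRing B] [CStarRing B] [NormedAlgebra ℂ B]
    [CompleteSpace B] [StarModule ℂ B] (f : A →⋆ₐ[ℂ] B) (x : A) : ‖f x‖ ≤ ‖x‖ := by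
  let _ : CStarAlgebra A := {}
  let _ : CStarAlgebra B := {}
  exact NonUnitalStarAlgHom.norm_apply_le f x

lemma aux_ofFn_mul {R : Type} [Monoid R] : ∀ (n : ℕ) (f g : Fin n → R),
    (∀ j k, j ≠ k → Commute (f j) (g k)) →
    (List.ofFn f).prod * (List.ofFn g).prod = (List.ofFn fun k => f k * g k).prod
  | 0, f, g, _ => by simp
  | n + 1, f, g, h => by
    simp only [List.ofFn_succ, List.prod_cons]
    rw [← aux_ofFn_mul n (fun i => f i.succ) (fun i => g i.succ)
      (fun j k hjk => h _ _ (by simpa using hjk))]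
    have hc : Commute (List.ofFn fun i : Fin n => f i.succ).prod (g 0) := by
      apply Commute.list_prod_left
      intro x hx
      rw [List.mem_ofFn] at hx
      obtain ⟨i, rfl⟩ := hx
      exact h _ _ (Fin.succ_ne_zero i)
    simp only [mul_assoc]
    rw [← mul_assoc _ (g 0), hc.eq]
    simp only [mul_assoc]

lemma aux_ofFn_single {R : Type} [Monoid R] : ∀ (n : ℕ) (k : Fin n) (x : R),
    (List.ofFn fun j => if j = k then x else 1).prod = x
  | 0, k, _ => k.elim0
  | n + 1, k, x => by
    rw [List.ofFn_succ, List.prod_cons]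
    refine Fin.cases ?_ (fun i => ?_) k
    · simp [Fin.succ_ne_zero]
    · have := aux_ofFn_single n i x
      simp [Fin.succ_ne_zero, eq_comm (a := (0 : Fin (n+1)))] at this ⊢
      exact this

/-- A word in the embedded copies is regrouped by copies. -/
lemma aux_regroup {M MN : Type} [Ring M] [StarRing M] [Algebra ℂ M] [Ring MN] [StarRing MN]
    [Algebra ℂ MN] (N : ℕ) (ι : Fin N → (M →⋆ₐ[ℂ] MN))
    (hc : ∀ j k : Fin N, j ≠ k → ∀ x y : M, Commute (ι j x) (ι k y)) (L : List (Fin N × M)) :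
    (L.map fun p => ι p.1 p.2).prod =
      (List.ofFn fun k => ι k (L.map fun p => if k = p.1 then p.2 else 1).prod).prod := by
  induction L with
  | nil => simp
  | cons p L ih =>
    rw [List.map_cons, List.prod_cons, ih]
    have h1 : ι p.1 p.2 = (List.ofFn fun j => ι j (if j = p.1 then p.2 else 1)).prod := by
      conv_lhs => rw [← aux_ofFn_single N p.1 (ι p.1 p.2)]
      congr 2
      funext j
      split_ifs with h
      · rw [h]
      · simp
    rw [h1, aux_ofFn_mul]
    · congr 2
      funext k
      rw [List.map_cons, List.prod_cons, map_mul]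
    · intro j k hjk
      exact hc _ _ hjk _ _

lemma aux_prod_single {M : Type} [Monoid M] : ∀ (n : ℕ) (i : Fin n) (x : Fin n → M),
    (∀ j, j ≠ i → x j = 1) → (List.ofFn x).prod = x i := by
  intro n i x h
  have : x = fun j => if j = i then x i else 1 := by
    funext j
    split_ifs with hj
    · rw [hj]
    · exact h j hj
  conv_lhs => rw [this]
  exact aux_ofFn_single n i (x i)

/-- The term vanishes when some copy is used exactly once. -/
lemma aux_vanish {M MN : Type} [Ring M] [StarRing M] [Algebra ℂ M] [Ring MN] [StarRing MN]
    [Algebra ℂ MN] (ρ : M →ₗ[ℂ] ℂ) (ρN : MN →ₗ[ℂ] ℂ) (N : ℕ) (ι : Fin N → (M →⋆ₐ[ℂ] MN))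
    (hc : ∀ j k : Fin N, j ≠ k → ∀ x y : M, Commute (ι j x) (ι k y))
    (hp : ∀ x : Fin N → M, ρN (List.ofFn fun k => ι k (x k)).prod = ∏ k, ρ (x k))
    (n : ℕ) (X : Fin n → M) (hX : ∀ i, ρ (X i) = 0) (r : Fin n → Fin N) (i : Fin n)
    (hi : ∀ j, j ≠ i → r j ≠ r i) :
    ρN (List.ofFn fun j => ι (r j) (X j)).prod = 0 := by
  have h := aux_regroup N ι hc (List.ofFn fun j => (r j, X j))
  simp only [List.map_ofFn, Function.comp_def] at h
  rw [h, hp]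
  apply Finset.prod_eq_zero (Finset.mem_univ (r i))
  rw [aux_prod_single n i]
  · simpa using hX i
  · intro j hj
    rw [if_neg (hi j hj).symm]

lemma aux_count (m N : ℕ) (hN : 0 < N) :
    (Finset.univ.filter fun r : Fin (2 * m) → Fin N => ∀ i, ∃ j, j ≠ i ∧ r j = r i).card
      ≤ N ^ m * m ^ (2 * m) := by
  classical
  let Φ : (Fin m → Fin N) × (Fin (2 * m) → Fin m) → (Fin (2 * m) → Fin N) := fun p => p.1 ∘ p.2
  have hsub : (Finset.univ.filter fun r : Fin (2 * m) → Fin N => ∀ i, ∃ j, j ≠ i ∧ r j = r i)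
      ⊆ Finset.univ.image Φ := by
    intro r hr
    simp only [Finset.mem_filter, Finset.mem_univ, true_and] at hr
    have hcard : (Finset.univ.image r).card * 2 ≤ 2 * m := by
      have := Finset.mul_card_image_le_card (f := r) (s := Finset.univ) (n := 2) ?_
      · simpa [mul_comm] using this
      · intro a ha
        obtain ⟨i, -, rfl⟩ := Finset.mem_image.mp ha
        obtain ⟨j, hji, hj⟩ := hr i
        apply Nat.succ_le_of_lt
        apply Finset.one_lt_card.mpr
        exact ⟨i, by simp, j, by simp [hj], hji.symm⟩
    have hle : (Finset.univ.image r).card ≤ m := by omega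
    set s := Finset.univ.image r with hs
    let e := s.equivFin
    let g : Fin m → Fin N := fun a =>
      if h : (a : ℕ) < s.card then (e.symm ⟨a, h⟩ : Fin N) else ⟨0, hN⟩
    refine Finset.mem_image.mpr ⟨(g, fun i => Fin.castLE hle (e ⟨r i, by simp [hs]⟩)),
      Finset.mem_univ _, ?_⟩
    funext i
    simp [Φ, g]
  refine (Finset.card_le_card hsub).trans (Finset.card_image_le.trans ?_)
  simp

lemma aux_word {M : Type} [NormedRing M] [StarRing M] [CStarRing M] [NormedAlgebra ℂ M]
    [CompleteSpace M] [StarModule ℂ M]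
    {MN : Type} [NormedRing MN] [StarRing MN] [CStarRing MN] [NormedAlgebra ℂ MN]
    [CompleteSpace MN] [StarModule ℂ MN]
    (ρ : M →ₗ[ℂ] ℂ) (ρN : MN →ₗ[ℂ] ℂ) (N : ℕ) (hN : 0 < N)
    (ι : Fin N → (M →⋆ₐ[ℂ] MN))
    (h0 : ∀ x : MN, 0 ≤ (ρN (star x * x)).re ∧ (ρN (star x * x)).im = 0)
    (h1 : ρN 1 = 1)
    (hc : ∀ j k : Fin N, j ≠ k → ∀ x y : M, Commute (ι j x) (ι k y))
    (hp : ∀ x : Fin N → M, ρN (List.ofFn fun k => ι k (x k)).prod = ∏ k, ρ (x k))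
    (m : ℕ) (L : List M) (hL : L.length = 2 * m) (hρ : ∀ x ∈ L, ρ x = 0) :
    ‖ρN (L.map fun x => ∑ k, ι k x).prod‖ ≤
      (N ^ m * m ^ (2 * m)) * (4 * (L.map fun x => ‖x‖).prod) := by
  classical
  have hnt : Nontrivial MN := by
    refine ⟨1, 0, fun h => ?_⟩
    rw [h, map_zero] at h1
    exact zero_ne_one h1
  obtain ⟨X, rfl⟩ : ∃ X : Fin (2 * m) → M, L = List.ofFn X :=
    hL ▸ ⟨L.get, (List.ofFn_get L).symm⟩
  have hX : ∀ i, ρ (X i) = 0 := fun i => hρ _ (by simp [List.mem_ofFn])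
  simp only [List.map_ofFn, Function.comp_def]
  have hexp := (MultilinearMap.mkPiAlgebraFin ℂ (2 * m) MN).map_sum
    (fun i (k : Fin N) => ι k (X i))
  simp only [MultilinearMap.mkPiAlgebraFin_apply] at hexp
  rw [hexp, map_sum]
  set G := Finset.univ.filter fun r : Fin (2 * m) → Fin N => ∀ i, ∃ j, j ≠ i ∧ r j = r i with hG
  have hsum : ∑ r : Fin (2 * m) → Fin N, ρN (List.ofFn fun i => ι (r i) (X i)).prod
      = ∑ r ∈ G, ρN (List.ofFn fun i => ι (r i) (X i)).prod := by
    symm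
    apply Finset.sum_subset (Finset.subset_univ _)
    intro r _ hr
    simp only [hG, Finset.mem_filter, Finset.mem_univ, true_and, not_forall] at hr
    obtain ⟨i, hi⟩ := hr
    refine aux_vanish ρ ρN N ι hc hp _ X hX r i ?_
    intro j hj h
    exact hi ⟨j, hj, h⟩
  rw [hsum]
  have hP : 0 ≤ 4 * (List.ofFn fun i => ‖X i‖).prod := by
    apply mul_nonneg (by norm_num)
    rw [List.prod_ofFn]
    exact Finset.prod_nonneg fun _ _ => norm_nonneg _
  have hterm : ∀ r ∈ G, ‖ρN (List.ofFn fun i => ι (r i) (X i)).prod‖ ≤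
      4 * (List.ofFn fun i => ‖X i‖).prod := by
    intro r _
    refine (aux_state_bound ρN h0 h1 _).trans ?_
    gcongr
    refine (List.norm_prod_le _).trans ?_
    rw [List.map_ofFn, List.prod_ofFn, List.prod_ofFn]
    exact Finset.prod_le_prod (fun _ _ => norm_nonneg _) (fun i _ => aux_hom_bound _ _)
  refine (norm_sum_le _ _).trans ((Finset.sum_le_card_nsmul _ _ _ hterm).trans ?_)
  rw [nsmul_eq_mul]
  refine mul_le_mul_of_nonneg_right ?_ hP
  exact_mod_cast aux_count m N hN

lemma aux_comm {R : Type} [Ring R] (x y : R) (a : ℕ) :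
    x ^ (a + 1) * y - y * x ^ (a + 1) =
      ∑ i ∈ Finset.range (a + 1), x ^ i * (x * y - y * x) * x ^ (a - i) := by
  have h := Finset.sum_range_sub (fun i => x ^ i * y * x ^ (a + 1 - i)) (a + 1)
  simp only [Nat.sub_self, pow_zero, mul_one, one_mul, Nat.sub_zero] at h
  rw [← h]
  apply Finset.sum_congr rfl
  intro i hi
  have hi' : i ≤ a := by
    have := Finset.mem_range.mp hi
    omega
  rw [show a + 1 - (i + 1) = a - i by omega, show a + 1 - i = (a - i) + 1 by omega,
    pow_succ x i, pow_succ' x (a - i)]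
  noncomm_ring

lemma aux_comm2 {R : Type} [Ring R] (x y : R) (a b : ℕ) :
    ⁅x ^ (a + 1), y ^ (b + 1)⁆ =
      - ∑ p ∈ Finset.range (a + 1) ×ˢ Finset.range (b + 1),
        x ^ p.1 * (y ^ p.2 * (y * x - x * y) * y ^ (b - p.2)) * x ^ (a - p.1) := by
  rw [Ring.lie_def, aux_comm x, Finset.sum_product, ← Finset.sum_neg_distrib]
  apply Finset.sum_congr rfl
  intro i _
  rw [← neg_sub (y ^ (b + 1) * x), aux_comm y x b]
  simp only [mul_neg, neg_mul, Finset.mul_sum, Finset.sum_mul]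

lemma aux_star_word {M MN : Type} [Ring M] [StarRing M] [Algebra ℂ M] [Ring MN] [StarRing MN]
    [Algebra ℂ MN] (N : ℕ) (ι : Fin N → (M →⋆ₐ[ℂ] MN)) (L : List M) :
    star (L.map fun x => ∑ k, ι k x).prod =
      ((L.map star).reverse.map fun x => ∑ k, ι k x).prod := by
  induction L with
  | nil => simp
  | cons x L ih =>
    rw [List.map_cons, List.prod_cons, star_mul, ih]
    simp [star_sum, map_star]

/-- Words of the expanded commutator. -/
def auxW {M : Type} (A B D : M) (a b : ℕ) (p : ℕ × ℕ) : List M :=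
  List.replicate p.1 A ++ (List.replicate p.2 B ++ [D] ++ List.replicate (b - p.2) B) ++
    List.replicate (a - p.1) A

lemma auxW_length {M : Type} (A B D : M) (a b : ℕ) (p : ℕ × ℕ)
    (hp : p ∈ Finset.range (a + 1) ×ˢ Finset.range (b + 1)) :
    (auxW A B D a b p).length = a + b + 1 := by
  simp only [Finset.mem_product, Finset.mem_range] at hp
  simp [auxW]
  omega

lemma auxW_mem {M : Type} (A B D : M) (a b : ℕ) (p : ℕ × ℕ) (x : M)
    (hx : x ∈ auxW A B D a b p) : x = A ∨ x = B ∨ x = D := by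
  simp only [auxW, List.mem_append, List.mem_replicate, List.mem_singleton] at hx
  tauto

lemma auxW_norm {M : Type} [NormedRing M] (A B D : M) (a b : ℕ) (p : ℕ × ℕ)
    (hp : p ∈ Finset.range (a + 1) ×ˢ Finset.range (b + 1)) :
    ((auxW A B D a b p).map fun x => ‖x‖).prod = ‖A‖ ^ a * ‖B‖ ^ b * ‖D‖ := by
  simp only [Finset.mem_product, Finset.mem_range] at hp
  simp only [auxW, List.map_append, List.map_replicate, List.prod_append, List.prod_replicate,
    List.map_cons, List.map_nil, List.prod_cons, List.prod_nil, mul_one]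
  have e1 : ‖A‖ ^ a = ‖A‖ ^ p.1 * ‖A‖ ^ (a - p.1) := by
    rw [← pow_add]; congr 1; omega
  have e2 : ‖B‖ ^ b = ‖B‖ ^ p.2 * ‖B‖ ^ (b - p.2) := by
    rw [← pow_add]; congr 1; omega
  rw [e1, e2]
  ring

lemma aux_main {M : Type} [NormedRing M] [StarRing M] [CStarRing M] [NormedAlgebra ℂ M]
    [CompleteSpace M] [StarModule ℂ M]
    {MN : Type} [NormedRing MN] [StarRing MN] [CStarRing MN] [NormedAlgebra ℂ MN]
    [CompleteSpace MN] [StarModule ℂ MN]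
    (ρ : M →ₗ[ℂ] ℂ) (ρN : MN →ₗ[ℂ] ℂ) (N : ℕ) (hN : 0 < N)
    (ι : Fin N → (M →⋆ₐ[ℂ] MN))
    (ht : ∀ x y : M, ρ (x * y) = ρ (y * x))
    (h0 : ∀ x : MN, 0 ≤ (ρN (star x * x)).re ∧ (ρN (star x * x)).im = 0)
    (h1 : ρN 1 = 1)
    (hc : ∀ j k : Fin N, j ≠ k → ∀ x y : M, Commute (ι j x) (ι k y))
    (hp : ∀ x : Fin N → M, ρN (List.ofFn fun k => ι k (x k)).prod = ∏ k, ρ (x k))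
    (A B : M) (hA : IsSelfAdjoint A) (hB : IsSelfAdjoint B) (hρA : ρ A = 0) (hρB : ρ B = 0)
    (a b : ℕ) :
    ‖ρN (star ⁅(∑ k, ι k A) ^ (a + 1), (∑ k, ι k B) ^ (b + 1)⁆ *
        ⁅(∑ k, ι k A) ^ (a + 1), (∑ k, ι k B) ^ (b + 1)⁆)‖ ≤
      (N : ℝ) ^ (a + b + 1) * (4 * ((a + 1) * (b + 1)) * (a + b + 1 : ℕ) ^ (a + b + 1)
        * ‖A‖ ^ (a + 1) * ‖B‖ ^ (b + 1)) ^ 2 := by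
  classical
  set D : M := B * A - A * B with hD
  have hρD : ρ D = 0 := by rw [hD, map_sub, ht, sub_self]
  have hDn : ‖D‖ ≤ 2 * (‖A‖ * ‖B‖) := by
    refine (norm_sub_le _ _).trans ?_
    have e1 := norm_mul_le A B
    have e2 := norm_mul_le B A
    nlinarith
  have hsD : star D = -D := by
    rw [hD, star_sub, star_mul, star_mul, hA.star_eq, hB.star_eq]
    abel
  have hSD : (∑ k, ι k B) * (∑ k, ι k A) - (∑ k, ι k A) * (∑ k, ι k B) = ∑ k, ι k D := by
    rw [Finset.sum_mul_sum, Finset.sum_mul_sum, Finset.sum_comm, ← Finset.sum_sub_distrib]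
    apply Finset.sum_congr rfl
    intro k _
    rw [← Finset.sum_sub_distrib, Finset.sum_eq_single k]
    · simp [hD]
    · intro j _ hj
      rw [(hc j k hj B A).eq, sub_self]
    · simp
  set P := Finset.range (a + 1) ×ˢ Finset.range (b + 1) with hP
  have hZ : ⁅(∑ k, ι k A) ^ (a + 1), (∑ k, ι k B) ^ (b + 1)⁆ =
      - ∑ p ∈ P, ((auxW A B D a b p).map fun x => ∑ k, ι k x).prod := by
    rw [aux_comm2, hSD]
    congr 1
    apply Finset.sum_congr rfl
    intro p _
    simp [auxW, List.prod_append, List.prod_replicate, mul_assoc]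
  rw [hZ, star_neg, neg_mul_neg, star_sum, Finset.sum_mul_sum, map_sum]
  set m := a + b + 1 with hm
  set Q : ℝ := (N ^ m * m ^ (2 * m)) * (4 * (‖A‖ ^ a * ‖B‖ ^ b * ‖D‖) ^ 2) with hQ
  have hterm : ∀ p ∈ P, ∀ q ∈ P,
      ‖ρN (star ((auxW A B D a b p).map fun x => ∑ k, ι k x).prod *
        ((auxW A B D a b q).map fun x => ∑ k, ι k x).prod)‖ ≤ Q := by
    intro p hp' q hq'
    rw [aux_star_word, ← List.prod_append, ← List.map_append]
    refine (aux_word ρ ρN N hN ι h0 h1 hc hp m _ ?_ ?_).trans (le_of_eq ?_)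
    · rw [List.length_append, List.length_reverse, List.length_map, auxW_length _ _ _ _ _ _ hp',
        auxW_length _ _ _ _ _ _ hq']
      omega
    · intro x hx
      rw [List.mem_append, List.mem_reverse, List.mem_map] at hx
      rcases hx with ⟨y, hy, rfl⟩ | hx
      · rcases auxW_mem _ _ _ _ _ _ _ hy with rfl | rfl | rfl
        · rw [hA.star_eq, hρA]
        · rw [hB.star_eq, hρB]
        · rw [hsD, map_neg, hρD, neg_zero]
      · rcases auxW_mem _ _ _ _ _ _ _ hx with rfl | rfl | rfl <;> assumption
    · rw [List.map_append, List.prod_append, List.map_reverse, List.prod_reverse, List.map_map]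
      have : ((fun x : M => ‖x‖) ∘ star) = fun x : M => ‖x‖ := by
        funext x
        simp
      rw [this, auxW_norm _ _ _ _ _ _ hp', auxW_norm _ _ _ _ _ _ hq', hQ]
      ring
  have hb : ‖∑ p ∈ P, ρN (∑ q ∈ P, star ((auxW A B D a b p).map fun x => ∑ k, ι k x).prod *
        ((auxW A B D a b q).map fun x => ∑ k, ι k x).prod)‖ ≤ P.card * (P.card * Q) := by
    refine (norm_sum_le _ _).trans ?_
    rw [← nsmul_eq_mul]
    apply Finset.sum_le_card_nsmul
    intro p hp'
    rw [map_sum]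
    refine (norm_sum_le _ _).trans ?_
    rw [← nsmul_eq_mul]
    exact Finset.sum_le_card_nsmul _ _ _ (hterm p hp')
  refine hb.trans ?_
  have hcard : (P.card : ℝ) = (a + 1) * (b + 1) := by simp [hP]
  rw [hcard, hQ]
  have hk : (‖A‖ ^ a * ‖B‖ ^ b * ‖D‖) ≤ 2 * (‖A‖ ^ (a + 1) * ‖B‖ ^ (b + 1)) := by
    calc _ ≤ ‖A‖ ^ a * ‖B‖ ^ b * (2 * (‖A‖ * ‖B‖)) := by gcongr
      _ = _ := by ring
  calc _ ≤ ((a : ℝ) + 1) * (b + 1) * ((a + 1) * (b + 1) * ((N ^ m * m ^ (2 * m)) *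
        (4 * (2 * (‖A‖ ^ (a + 1) * ‖B‖ ^ (b + 1))) ^ 2))) := by gcongr
    _ = _ := by ring


/-- Commutator estimate: for a tracial state `ρ` on a unital C*-algebra `M`, mean-zero
self-adjoint `A, B`, and the rescaled averages `Ã, B̃` of `N` independent (tensor)
copies — encoded by star-algebra embeddings `ι k : M → MN` with commuting ranges whose
ordered products are evaluated multiplicatively by the product state `ρN` — the GNS
norm of `[Ã^α, B̃^β]` is at most `C N^{-1/2} ‖A‖^α ‖B‖^β`, with `C = C(α, β)`. -/
theorem gns_norm_commutator_powers_le (α β : ℕ) :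
    ∃ C : ℝ, 0 < C ∧
      ∀ (M : Type) [NormedRing M] [StarRing M] [CStarRing M] [NormedAlgebra ℂ M]
        [CompleteSpace M] [StarModule ℂ M]
        (MN : Type) [NormedRing MN] [StarRing MN] [CStarRing MN] [NormedAlgebra ℂ MN]
        [CompleteSpace MN] [StarModule ℂ MN]
        (ρ : M →ₗ[ℂ] ℂ) (ρN : MN →ₗ[ℂ] ℂ) (N : ℕ) (_hN : 0 < N)
        (ι : Fin N → (M →⋆ₐ[ℂ] MN)),
        (∀ x : M, 0 ≤ (ρ (star x * x)).re ∧ (ρ (star x * x)).im = 0) →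
        (ρ 1 = 1) →
        (∀ x y : M, ρ (x * y) = ρ (y * x)) →
        (∀ x : MN, 0 ≤ (ρN (star x * x)).re ∧ (ρN (star x * x)).im = 0) →
        (ρN 1 = 1) →
        (∀ j k : Fin N, j ≠ k → ∀ x y : M, Commute (ι j x) (ι k y)) →
        (∀ x : Fin N → M,
          ρN (List.ofFn fun k => ι k (x k)).prod = ∏ k, ρ (x k)) →
        ∀ A B : M, IsSelfAdjoint A → IsSelfAdjoint B → ρ A = 0 → ρ B = 0 →
        Real.sqrt ((ρN (star
            ⁅(((Real.sqrt N : ℂ))⁻¹ • ∑ k, ι k A) ^ α,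
              (((Real.sqrt N : ℂ))⁻¹ • ∑ k, ι k B) ^ β⁆ *
            ⁅(((Real.sqrt N : ℂ))⁻¹ • ∑ k, ι k A) ^ α,
              (((Real.sqrt N : ℂ))⁻¹ • ∑ k, ι k B) ^ β⁆)).re) ≤
          C * (Real.sqrt N)⁻¹ * ‖A‖ ^ α * ‖B‖ ^ β := by
  obtain _ | a := α
  · refine ⟨1, one_pos, ?_⟩
    intros
    simp only [pow_zero, Ring.lie_def, one_mul, mul_one, sub_self, mul_zero, map_zero,
      Complex.zero_re, Real.sqrt_zero]
    positivity
  obtain _ | b := β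
  · refine ⟨1, one_pos, ?_⟩
    intros
    simp only [pow_zero, Ring.lie_def, one_mul, mul_one, sub_self, mul_zero, map_zero,
      Complex.zero_re, Real.sqrt_zero]
    positivity
  refine ⟨4 * ((a + 1) * (b + 1)) * (a + b + 1 : ℕ) ^ (a + b + 1), by positivity, ?_⟩
  intro M _ _ _ _ _ _ MN _ _ _ _ _ _ ρ ρN N hN ι _ _ ht h0 h1 hc hp A B hA hB hρA hρB
  have key := aux_main ρ ρN N hN ι ht h0 h1 hc hp A B hA hB hρA hρB a b
  set SA := ∑ k, ι k A
  set SB := ∑ k, ι k B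
  have hNr : (0 : ℝ) < N := by exact_mod_cast hN
  set s : ℝ := (Real.sqrt N)⁻¹ with hs
  have hs0 : 0 ≤ s := by positivity
  have hs2 : s ^ 2 = (N : ℝ)⁻¹ := by rw [hs, inv_pow, Real.sq_sqrt hNr.le]
  have hsC : ((Real.sqrt N : ℂ))⁻¹ = (s : ℂ) := by simp [hs]
  have hlie : ⁅(((Real.sqrt N : ℂ))⁻¹ • SA) ^ (a + 1), (((Real.sqrt N : ℂ))⁻¹ • SB) ^ (b + 1)⁆
      = ((s ^ (a + b + 2) : ℝ) : ℂ) • ⁅SA ^ (a + 1), SB ^ (b + 1)⁆ := by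
    rw [hsC, smul_pow, smul_pow, Ring.lie_def, Ring.lie_def, smul_mul_smul_comm,
      smul_mul_smul_comm, smul_sub, mul_comm ((s : ℂ) ^ (b + 1)), ← pow_add]
    have e : a + 1 + (b + 1) = a + b + 2 := by ring
    rw [e]
    push_cast
    rfl
  rw [hlie]
  set Z := ⁅SA ^ (a + 1), SB ^ (b + 1)⁆
  rw [star_smul, smul_mul_smul_comm, map_smul]
  have hcc : star ((s ^ (a + b + 2) : ℝ) : ℂ) * ((s ^ (a + b + 2) : ℝ) : ℂ)
      = ((s ^ (a + b + 2)) ^ 2 : ℝ) := by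
    simp [sq]
  rw [hcc, smul_eq_mul, Complex.re_ofReal_mul]
  set K : ℝ := 4 * ((a + 1) * (b + 1)) * (a + b + 1 : ℕ) ^ (a + b + 1) with hK
  apply Real.sqrt_le_iff.mpr
  constructor
  · positivity
  have hre := (Complex.re_le_norm _).trans key
  calc (s ^ (a + b + 2)) ^ 2 * (ρN (star Z * Z)).re
      ≤ (s ^ (a + b + 2)) ^ 2 *
        ((N : ℝ) ^ (a + b + 1) * (K * ‖A‖ ^ (a + 1) * ‖B‖ ^ (b + 1)) ^ 2) := by gcongr
    _ = (s ^ 2 * N) ^ (a + b + 1) * (K * s * ‖A‖ ^ (a + 1) * ‖B‖ ^ (b + 1)) ^ 2 := by ring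
    _ = (K * s * ‖A‖ ^ (a + 1) * ‖B‖ ^ (b + 1)) ^ 2 := by
      rw [hs2, inv_mul_cancel₀ hNr.ne', one_pow, one_mul]
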